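/- K_1 is one-dimensional with basis [0], and δ_2(K_2) = K_1; consequently (since δ_1 = 0) the quotient K_1/δ_2(K_2) is zero. (In the paper's interpretation this says H^1(U(3), ℚ) = 0.) -/

import Mathlib

open Finset

/-- A list `[m_1, …, m_n]` of natural numbers is an Anick chain if it is nonempty,
`m_j ≥ 2` for all `1 ≤ j ≤ n-2`, and (when `n ≥ 2`) either `m_{n-1} ≥ 2` or
`(m_{n-1}, m_n) = (1, 0)`. -/
def AnickChain (l : List ℕ) : Prop :=
  l ≠ [] ∧ (∀ j, j + 2 < l.length → 2 ≤ l.getD j 0) ∧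
    (2 ≤ l.length →
      2 ≤ l.getD (l.length - 2) 0 ∨
        (l.getD (l.length - 2) 0 = 1 ∧ l.getD (l.length - 1) 0 = 0))

/-- The ℚ-vector space with basis the set of all Anick chains (of all lengths);
its length-homogeneous components are the spaces `A_n`. -/
abbrev AnickSpace : Type := {l : List ℕ // AnickChain l} →₀ ℚ

open Classical in
/-- The basis element `[m_1|…|m_n]` attached to a list; by convention it is `0`
if the list is not an Anick chain. -/
noncomputable def br (l : List ℕ) : AnickSpace :=
  if h : AnickChain l then Finsupp.single ⟨l, h⟩ 1 else 0

/-- The `j`-th entry of a list, `1`-based (with default value 0). -/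
def ent (l : List ℕ) (j : ℕ) : ℕ := l.getD (j - 1) 0

/-- Replace the pair of entries at (1-based) positions `j, j+1` by the single entry `c`. -/
def mergeAt (l : List ℕ) (j c : ℕ) : List ℕ := l.take (j - 1) ++ c :: l.drop (j + 1)

/-- Decrease the (1-based) `t`-th entry by one. -/
def decAt (l : List ℕ) (t : ℕ) : List ℕ := l.set (t - 1) (ent l t - 1)

open Classical in
/-- The value of the Anick differential on the basis chain `[i_1|…|i_{n+1}]`. -/
noncomputable def deltaFun (l : List ℕ) : AnickSpace :=
  let n := l.length - 1
  let i : ℕ → ℚ := fun j => (ent l j : ℚ)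
  if 2 ≤ ent l n then
    (∑ j ∈ Icc 1 n, ((-1 : ℚ) ^ j * (i j * (i j - 1) / (i j + i (j + 1) - 1))) •
        br (mergeAt l j (ent l j + ent l (j + 1) - 1)))
    + (∑ j ∈ Icc 2 n, ∑ t ∈ Icc 1 (j - 1),
        ((-1 : ℚ) ^ j * (i t * (i j - 1) * (i (j + 1) - 1) / (i j + i (j + 1) - 1))) •
          br (mergeAt (decAt l t) j (ent l j + ent l (j + 1))))
    + (∑ j ∈ Icc 2 n, ∑ t ∈ Icc 1 (j - 1),
        ((-1 : ℚ) ^ j * (i j * i (j + 1) * (i t - 1) / (i j + i (j + 1) - 1))) •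
          br (mergeAt l j (ent l j + ent l (j + 1) - 1)))
  else if ent l n = 1 ∧ ent l (n + 1) = 0 then
    (∑ j ∈ Icc 1 (n - 2), ((-1 : ℚ) ^ j * (i j * (i j - 1) / (i j + i (j + 1) - 1))) •
        br (mergeAt l j (ent l j + ent l (j + 1) - 1)))
    + (∑ j ∈ Icc 2 (n - 2), ∑ t ∈ Icc 1 (j - 1),
        ((-1 : ℚ) ^ j * (i t * (i j - 1) * (i (j + 1) - 1) / (i j + i (j + 1) - 1))) •
          br (mergeAt (decAt l t) j (ent l j + ent l (j + 1))))
    + (∑ j ∈ Icc 2 (n - 2), ∑ t ∈ Icc 1 (j - 1),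
        ((-1 : ℚ) ^ j * (i j * i (j + 1) * (i t - 1) / (i j + i (j + 1) - 1))) •
          br (mergeAt l j (ent l j + ent l (j + 1) - 1)))
    + (∑ j ∈ Icc 1 (n - 1), ((-1 : ℚ) ^ n * i j) • br ((decAt l j).dropLast))
    + (∑ j ∈ Icc 1 (n - 1), ((-1 : ℚ) ^ (n - 1) * (i j - 1)) • br (l.take (n - 1) ++ [0]))
    + ((-1 : ℚ) ^ n • br (l.take (n - 1) ++ [0]))
  else 0

/-- The Anick differential `δ` (the direct sum of all the maps `δ_n`; on the
length-one component it vanishes, i.e. `δ_1 = 0`). -/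
noncomputable def anickDelta : AnickSpace →ₗ[ℚ] AnickSpace :=
  Finsupp.linearCombination ℚ (fun c => deltaFun c.1)

/-- The value of `∂̃` on a basis chain. -/
noncomputable def dtilFun (l : List ℕ) : AnickSpace :=
  ∑ j ∈ Finset.range l.length, (l.getD j 0 : ℚ) • br (l.set j (l.getD j 0 - 1))

/-- The derivation `∂̃` on the Anick complex. -/
noncomputable def dtil : AnickSpace →ₗ[ℚ] AnickSpace :=
  Finsupp.linearCombination ℚ (fun c => dtilFun c.1)

/-- `A_n`: the span of the Anick chains of length `n`. -/
noncomputable def A (n : ℕ) : Submodule ℚ AnickSpace :=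
  Finsupp.supported ℚ ℚ {c | c.1.length = n}

/-- `A_{n,k}`: the span of the Anick chains of length `n` whose last entry is `≥ k`. -/
noncomputable def Ak (n k : ℕ) : Submodule ℚ AnickSpace :=
  Finsupp.supported ℚ ℚ {c | c.1.length = n ∧ k ≤ c.1.getD (n - 1) 0}

/-- `A_n^{(d)}`: the span of the Anick chains of length `n` and degree `d`. -/
noncomputable def Adeg (n d : ℕ) : Submodule ℚ AnickSpace :=
  Finsupp.supported ℚ ℚ {c | c.1.length = n ∧ c.1.sum = d}

/-- `A_n^{(d)∘}`: the span of the regular Anick chains (all entries `≥ 2`) of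
length `n` and degree `d`. -/
noncomputable def Areg (n d : ℕ) : Submodule ℚ AnickSpace :=
  Finsupp.supported ℚ ℚ {c | c.1.length = n ∧ c.1.sum = d ∧ ∀ j < n, 2 ≤ c.1.getD j 0}

/-- `K_n = ker ∂̃_n ⊆ A_n`. -/
noncomputable def K (n : ℕ) : Submodule ℚ AnickSpace := A n ⊓ LinearMap.ker dtil

/-- `K_n^{(d)} = K_n ∩ A_n^{(d)}`. -/
noncomputable def Kdeg (n d : ℕ) : Submodule ℚ AnickSpace := K n ⊓ Adeg n d

open Classical in
/-- The component map `a ↦ a_i`: keep only the chains whose last entry is `i`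
and delete that last entry. -/
noncomputable def component (i : ℕ) : AnickSpace →ₗ[ℚ] AnickSpace :=
  Finsupp.linearCombination ℚ
    (fun c => if c.1.getLast? = some i then br c.1.dropLast else 0)

/-- The elements `e_1 = [1|0]` and `e_d = Σ_{s=0}^{d-2} (-1)^s C(d,s) [d-s|s]` for `d ≥ 3`. -/
noncomputable def eElt (d : ℕ) : AnickSpace :=
  if d = 1 then br [1, 0]
  else ∑ s ∈ Finset.range (d - 1), ((-1 : ℚ) ^ s * (d.choose s : ℚ)) • br [d - s, s]

theorem anickChain_singleton (m : ℕ) : AnickChain [m] := by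
  simp [AnickChain]

theorem anickChain_pair (a b : ℕ) : AnickChain [a, b] ↔ 2 ≤ a ∨ (a = 1 ∧ b = 0) := by
  simp [AnickChain]

theorem br_of_chain {l : List ℕ} (h : AnickChain l) : br l = Finsupp.single ⟨l, h⟩ 1 :=
  dif_pos h

theorem br_of_not_chain {l : List ℕ} (h : ¬ AnickChain l) : br l = 0 :=
  dif_neg h

theorem br_mem_A {l : List ℕ} {n : ℕ} (hl : l.length = n) : br l ∈ A n := by
  by_cases h : AnickChain l
  · rw [br_of_chain h]
    exact Finsupp.single_mem_supported ℚ 1 hl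
  · rw [br_of_not_chain h]
    exact zero_mem _

theorem A_eq_span (n : ℕ) :
    A n = Submodule.span ℚ {x | ∃ l, AnickChain l ∧ l.length = n ∧ br l = x} := by
  rw [A, Finsupp.supported_eq_span_single]
  congr 1
  ext x
  constructor
  · rintro ⟨⟨l, h⟩, hl, rfl⟩
    exact ⟨l, h, hl, br_of_chain h⟩
  · rintro ⟨l, h, hl, rfl⟩
    exact ⟨⟨l, h⟩, hl, (br_of_chain h).symm⟩

theorem anickDelta_br {l : List ℕ} (h : AnickChain l) : anickDelta (br l) = deltaFun l := by
  simp [anickDelta, br_of_chain h]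

theorem dtil_br {l : List ℕ} (h : AnickChain l) : dtil (br l) = dtilFun l := by
  simp [dtil, br_of_chain h]

theorem dtil_br_singleton (m : ℕ) : dtil (br [m]) = (m : ℚ) • br [m - 1] := by
  simp [dtil_br (anickChain_singleton m), dtilFun]

theorem dtil_br_pair {a b : ℕ} (h : AnickChain [a, b]) :
    dtil (br [a, b]) = (a : ℚ) • br [a - 1, b] + (b : ℚ) • br [a, b - 1] := by
  simp [dtil_br h, dtilFun, Finset.sum_range_succ]

theorem anickDelta_br_pair {a b : ℕ} (h : 2 ≤ a) :
    anickDelta (br [a, b]) =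
      (-((a : ℚ) * (a - 1) / (a + b - 1))) • br [a + b - 1] := by
  rw [anickDelta_br ((anickChain_pair a b).2 (Or.inl h))]
  simp [deltaFun, ent, mergeAt, h]

theorem anickDelta_br_one_zero : anickDelta (br [1, 0]) = -br [0] := by
  rw [anickDelta_br ((anickChain_pair 1 0).2 (by simp))]
  simp [deltaFun, ent]

theorem dtil_br_one_zero : dtil (br [1, 0]) = 0 := by
  rw [dtil_br_pair ((anickChain_pair 1 0).2 (by simp)),
    br_of_not_chain (l := [1 - 1, 0]) (by simp [anickChain_pair])]
  simp

theorem dtil_anickDelta_br_pair {a b : ℕ} (h : AnickChain [a, b]) :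
    dtil (anickDelta (br [a, b])) = anickDelta (dtil (br [a, b])) := by
  rcases (anickChain_pair a b).1 h with ha | ⟨rfl, rfl⟩
  · have hsum : ((a + b - 1 : ℕ) : ℚ) = a + b - 1 := by
      rw [Nat.cast_sub (by omega)]; push_cast; ring
    have haq : (2 : ℚ) ≤ a := by exact_mod_cast ha
    have hbq : (0 : ℚ) ≤ b := by positivity
    have hne : (a : ℚ) + b - 1 ≠ 0 := by linarith
    have hl : dtil (anickDelta (br [a, b])) = (-((a : ℚ) * (a - 1))) • br [a + b - 2] := by
      rw [anickDelta_br_pair ha, map_smul, dtil_br_singleton, smul_smul, hsum,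
        show a + b - 1 - 1 = a + b - 2 by omega]
      congr 1
      field_simp
    have hsnd : anickDelta ((b : ℚ) • br [a, b - 1]) =
        (-(b * ((a : ℚ) * (a - 1) / (a + b - 2)))) • br [a + b - 2] := by
      rcases Nat.eq_zero_or_pos b with rfl | hb
      · simp
      · rw [map_smul, anickDelta_br_pair ha, smul_smul, Nat.cast_sub hb,
          show a + (b - 1) - 1 = a + b - 2 by omega]
        congr 1
        push_cast
        ring
    rw [hl, dtil_br_pair h, map_add, hsnd, map_smul]
    rcases ha.eq_or_lt with rfl | ha3
    · rcases Nat.eq_zero_or_pos b with rfl | hb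
      · rw [show 2 - 1 = 1 from rfl, anickDelta_br_one_zero]
        norm_num
      · rw [br_of_not_chain (l := [2 - 1, b]) (by simp [anickChain_pair]; omega)]
        have hb0 : (b : ℚ) ≠ 0 := by positivity
        simp only [map_zero, smul_zero, zero_add]
        congr 1
        push_cast
        rw [show (2 : ℚ) + b - 2 = b by ring]
        field_simp
    · have ha3q : (3 : ℚ) ≤ a := by exact_mod_cast ha3
      have hne2 : (a : ℚ) + b - 2 ≠ 0 := by linarith
      rw [anickDelta_br_pair (by omega), smul_smul, Nat.cast_sub (by omega),
        show a - 1 + b - 1 = a + b - 2 by omega, ← add_smul]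
      congr 1
      push_cast
      rw [show (a : ℚ) - 1 + b - 1 = a + b - 2 by ring]
      field_simp
      ring
  · rw [anickDelta_br_one_zero, dtil_br_one_zero, map_neg, dtil_br_singleton]
    simp

theorem dtil_anickDelta {x : AnickSpace} (hx : x ∈ A 2) :
    dtil (anickDelta x) = anickDelta (dtil x) := by
  rw [A_eq_span] at hx
  refine LinearMap.eqOn_span (f := dtil ∘ₗ anickDelta) (g := anickDelta ∘ₗ dtil) ?_ hx
  rintro _ ⟨l, h, hl, rfl⟩
  obtain ⟨a, b, rfl⟩ := List.length_eq_two.1 hl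
  exact dtil_anickDelta_br_pair h

theorem anickDelta_mem_A_one {x : AnickSpace} (hx : x ∈ A 2) : anickDelta x ∈ A 1 := by
  rw [A_eq_span] at hx
  refine (Submodule.span_le (p := (A 1).comap anickDelta)).2 ?_ hx
  rintro _ ⟨l, h, hl, rfl⟩
  obtain ⟨a, b, rfl⟩ := List.length_eq_two.1 hl
  rw [SetLike.mem_coe, Submodule.mem_comap]
  rcases (anickChain_pair a b).1 h with ha | ⟨rfl, rfl⟩
  · rw [anickDelta_br_pair ha]
    exact Submodule.smul_mem _ _ (br_mem_A rfl)
  · rw [anickDelta_br_one_zero]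
    exact Submodule.neg_mem _ (br_mem_A rfl)

theorem dtil_apply_singleton {x : AnickSpace} (hx : x ∈ A 1) (m : ℕ) :
    dtil x ⟨[m], anickChain_singleton m⟩ =
      (m + 1) * x ⟨[m + 1], anickChain_singleton (m + 1)⟩ := by
  rw [A_eq_span] at hx
  refine LinearMap.eqOn_span
    (f := Finsupp.lapply ⟨[m], anickChain_singleton m⟩ ∘ₗ dtil)
    (g := ((m : ℚ) + 1) • Finsupp.lapply ⟨[m + 1], anickChain_singleton (m + 1)⟩) ?_ hx
  rintro _ ⟨l, -, hl, rfl⟩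
  obtain ⟨k, rfl⟩ := List.length_eq_one_iff.1 hl
  rw [LinearMap.comp_apply, dtil_br_singleton, br_of_chain (anickChain_singleton _),
    br_of_chain (anickChain_singleton _)]
  rcases k with _ | k
  · simp
  · by_cases hk : k = m <;> simp [hk]

theorem K_one_eq_span : K 1 = Submodule.span ℚ {br [0]} := by
  apply le_antisymm
  · rintro x ⟨hx, hker⟩
    refine Submodule.mem_span_singleton.2 ⟨x ⟨[0], anickChain_singleton 0⟩, ?_⟩
    rw [br_of_chain (anickChain_singleton 0)]
    ext ⟨l, h⟩
    by_cases hl : l.length = 1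
    · obtain ⟨k, rfl⟩ := List.length_eq_one_iff.1 hl
      rcases k with _ | k
      · simp
      · have hk := dtil_apply_singleton hx k
        rw [LinearMap.mem_ker.1 hker, Finsupp.zero_apply, zero_eq_mul] at hk
        rw [hk.resolve_left (by positivity)]
        simp
    · have hxl : x ⟨l, h⟩ = 0 := by
        by_contra hne
        exact hl (hx (Finsupp.mem_support_iff.2 hne))
      have hne : ([0] : List ℕ) ≠ l := by
        rintro rfl
        exact hl rfl
      simp [hxl, hne]
  · rw [Submodule.span_singleton_le_iff_mem]
    exact ⟨br_mem_A rfl, by simp [dtil_br_singleton]⟩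

/-- `K_1` is one-dimensional with basis `[0]`, and `δ_2(K_2) = K_1`;
hence `H^1(U(3), ℚ) = 0`. -/
theorem H1_of_U3_trivial :
    K 1 = Submodule.span ℚ {br [0]} ∧ br [0] ≠ 0 ∧
      Submodule.map anickDelta (K 2) = K 1 := by
  refine ⟨K_one_eq_span, ?_, le_antisymm ?_ ?_⟩
  · simp [br_of_chain (anickChain_singleton 0)]
  · rintro _ ⟨x, ⟨hx, hker⟩, rfl⟩
    refine ⟨anickDelta_mem_A_one hx, ?_⟩
    rw [SetLike.mem_coe, LinearMap.mem_ker, dtil_anickDelta hx, LinearMap.mem_ker.1 hker, map_zero]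
  · rw [K_one_eq_span, Submodule.span_singleton_le_iff_mem]
    refine ⟨-br [1, 0], Submodule.neg_mem _ ⟨br_mem_A rfl, dtil_br_one_zero⟩, ?_⟩
    rw [map_neg, anickDelta_br_one_zero, neg_neg]
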